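/- arXiv:1401.8150 — 5 statements merged into one kernel-verified Lean document; each statement's English description precedes it below -/
import Mathlib

section
/- For every separable complex Hilbert space H and every bounded linear operator L : H → H, there exists a sequence {f_n}_{n=1}^∞ in H which is an atomic system for L. -/
open Filter Topology
open scoped ComplexInnerProductSpace

/-- A sequence `f` in a Hilbert space is an *atomic system* for a bounded operator `L` if
(a) the series `∑ n, c n • f n` converges for every `c ∈ ℓ²`, and
(b) there is `C > 0` such that every `x` admits coefficients `a ∈ ℓ²` with
`‖a‖ ≤ C * ‖x‖` and `L x = ∑ n, a n • f n`. -/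
def AtomicSystem {H : Type*} [NormedAddCommGroup H] [InnerProductSpace ℂ H]
    (L : H →L[ℂ] H) (f : ℕ → H) : Prop :=
  (∀ c : lp (fun _ : ℕ => ℂ) 2,
      ∃ y : H, Tendsto (fun N => ∑ n ∈ Finset.range N, c n • f n) atTop (𝓝 y)) ∧
  ∃ C > (0 : ℝ), ∀ x : H, ∃ a : lp (fun _ : ℕ => ℂ) 2, ‖a‖ ≤ C * ‖x‖ ∧
      Tendsto (fun N => ∑ n ∈ Finset.range N, a n • f n) atTop (𝓝 (L x))

/-- An orthonormal family in a separable inner product space is countable. -/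
theorem Orthonormal.countable_of_separableSpace {𝕜 E ι : Type*} [RCLike 𝕜]
    [NormedAddCommGroup E] [InnerProductSpace 𝕜 E] [TopologicalSpace.SeparableSpace E]
    {v : ι → E} (hv : Orthonormal 𝕜 v) : Countable ι := by
  refine Pairwise.countable_of_isOpen_disjoint (s := fun i => Metric.ball (v i) (1 / 2))
    (fun i j hij => Metric.ball_disjoint_ball ?_) (fun _ => Metric.isOpen_ball)
    (fun i => ⟨v i, Metric.mem_ball_self (by norm_num)⟩)
  have h : ‖v i - v j‖ ^ 2 = 2 := by
    rw [norm_sub_sq (𝕜 := 𝕜), hv.1 i, hv.1 j, hv.2 hij]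
    norm_num
  rw [dist_eq_norm]
  nlinarith [norm_nonneg (v i - v j)]

/-- Extending an `ℓ²` family by zero along an injection gives an `ℓ²` family of the same norm. -/
theorem lp.exists_extend_zero {𝕜 ι κ : Type*} [NormedField 𝕜] {e : ι → κ}
    (he : Function.Injective e) (c : lp (fun _ : ι => 𝕜) 2) :
    ∃ a : lp (fun _ : κ => 𝕜) 2, ‖a‖ = ‖c‖ ∧ ∀ i, a (e i) = c i := by
  have h2 : 0 < (2 : ENNReal).toReal := by norm_num
  have hsum : HasSum (fun k => ‖Function.extend e c 0 k‖ ^ (2 : ENNReal).toReal)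
      (‖c‖ ^ (2 : ENNReal).toReal) := by
    rw [← he.hasSum_iff]
    · simpa only [Function.comp_def, he.extend_apply] using lp.hasSum_norm h2 c
    · intro k hk
      simp [Function.extend_apply' _ _ _ hk]
  refine ⟨⟨Function.extend e c 0, memℓp_gen hsum.summable⟩, ?_, fun i => he.extend_apply _ _ i⟩
  rw [← Real.rpow_left_inj (norm_nonneg _) (norm_nonneg _) h2.ne', lp.norm_rpow_eq_tsum h2]
  exact hsum.tsum_eq

/-- An `ℓ²` family pulled back along an injection is `ℓ²`. -/
theorem lp.exists_comp_injective {𝕜 ι κ : Type*} [NormedField 𝕜] {e : ι → κ}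
    (he : Function.Injective e) (a : lp (fun _ : κ => 𝕜) 2) :
    ∃ c : lp (fun _ : ι => 𝕜) 2, ∀ i, a (e i) = c i :=
  have h2 : 0 < (2 : ENNReal).toReal := by norm_num
  ⟨⟨fun i => a (e i), memℓp_gen (((lp.memℓp a).summable h2).comp_injective he)⟩, fun _ => rfl⟩

/-- Every bounded linear operator on a separable complex Hilbert space admits an atomic
system. -/
theorem exists_atomicSystem (H : Type*) [NormedAddCommGroup H] [InnerProductSpace ℂ H]
    [CompleteSpace H] [TopologicalSpace.SeparableSpace H] (L : H →L[ℂ] H) :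
    ∃ f : ℕ → H, AtomicSystem L f := by
  obtain ⟨w, b, -⟩ := exists_hilbertBasis ℂ H
  have : Countable w := b.orthonormal.countable_of_separableSpace
  obtain ⟨e, he⟩ := exists_injective_nat w
  have key (a : lp (fun _ : ℕ => ℂ) 2) (c : lp (fun _ : w => ℂ) 2) (hac : ∀ i, a (e i) = c i) :
      Tendsto (fun N => ∑ n ∈ Finset.range N, a n • Function.extend e (fun i => L (b i)) 0 n)
        atTop (𝓝 (L (b.repr.symm c))) := by
    refine HasSum.tendsto_sum_nat ((he.hasSum_iff fun n hn => ?_).1 ?_)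
    · simp [Function.extend_apply' _ _ _ hn]
    · simpa [Function.comp_def, he.extend_apply, hac] using L.hasSum (b.hasSum_repr_symm c)
  refine ⟨Function.extend e (fun i => L (b i)) 0, fun a => ?_, 1, one_pos, fun x => ?_⟩
  · obtain ⟨c, hc⟩ := lp.exists_comp_injective he a
    exact ⟨_, key a c hc⟩
  · obtain ⟨a, ha, hac⟩ := lp.exists_extend_zero he (b.repr x)
    refine ⟨a, by simp [ha], ?_⟩
    simpa using key a (b.repr x) hac
end

section
/- If {f_n}_{n=1}^∞ is an atomic system for L, then {f_n}_{n=1}^∞ is an L-frame; that is, there exist constants A, B > 0 such that A‖L*x‖² ≤ Σ_{n=1}^∞ |⟨x, f_n⟩|² ≤ B‖x‖² for all x ∈ H. -/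
open Filter Topology
open scoped ComplexInnerProductSpace

/-- A sequence `f` is an *`L`-frame* if there are `A, B > 0` with
`A * ‖L* x‖ ^ 2 ≤ ∑' n, |⟨x, f n⟩| ^ 2 ≤ B * ‖x‖ ^ 2` for all `x`. -/
def LFrame {H : Type*} [NormedAddCommGroup H] [InnerProductSpace ℂ H] [CompleteSpace H]
    (L : H →L[ℂ] H) (f : ℕ → H) : Prop :=
  ∃ A > (0 : ℝ), ∃ B > (0 : ℝ), ∀ x : H,
    Summable (fun n => ‖⟪x, f n⟫‖ ^ 2) ∧
    A * ‖ContinuousLinearMap.adjoint L x‖ ^ 2 ≤ ∑' n, ‖⟪x, f n⟫‖ ^ 2 ∧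
    ∑' n, ‖⟪x, f n⟫‖ ^ 2 ≤ B * ‖x‖ ^ 2

open Finset in
/-- If `∑ n, c n • f n` converges for every `c ∈ ℓ²`, its partial sums are bounded by a uniform
multiple of `‖c‖`. -/
theorem exists_norm_sum_smul_le {H : Type*} [NormedAddCommGroup H] [InnerProductSpace ℂ H]
    (f : ℕ → H)
    (hf : ∀ c : lp (fun _ : ℕ => ℂ) 2,
      ∃ y : H, Tendsto (fun N => ∑ n ∈ range N, c n • f n) atTop (𝓝 y)) :
    ∃ K > (0 : ℝ), ∀ (N : ℕ) (c : lp (fun _ : ℕ => ℂ) 2),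
      ‖∑ n ∈ range N, c n • f n‖ ≤ K * ‖c‖ := by
  let T : ℕ → lp (fun _ : ℕ => ℂ) 2 →L[ℂ] H := fun N =>
    ∑ n ∈ range N, (lp.evalCLM ℂ (fun _ : ℕ => ℂ) 2 n).smulRight (f n)
  have hT : ∀ N c, T N c = ∑ n ∈ range N, c n • f n := fun N c => by
    simp [T, lp.evalCLM]
  obtain ⟨K, hK⟩ : ∃ K, ∀ N, ‖T N‖ ≤ K := by
    refine banach_steinhaus fun c => ?_
    obtain ⟨y, hy⟩ := hf c
    obtain ⟨M, hM⟩ := hy.norm.bddAbove_range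
    exact ⟨M, fun N => by rw [hT]; exact hM ⟨N, rfl⟩⟩
  refine ⟨max K 1, by positivity, fun N c => ?_⟩
  rw [← hT]
  exact (T N).le_of_opNorm_le ((hK N).trans (le_max_left _ _)) c

open Finset in
/-- A uniform bound on the partial sums `∑ n, c n • f n`, `c ∈ ℓ²`, is a Bessel bound. -/
theorem sum_norm_inner_sq_le_of_norm_sum_smul_le {H : Type*} [NormedAddCommGroup H]
    [InnerProductSpace ℂ H] {f : ℕ → H} {K : ℝ} {N : ℕ}
    (h : ∀ c : lp (fun _ : ℕ => ℂ) 2, ‖∑ n ∈ range N, c n • f n‖ ≤ K * ‖c‖) (x : H) :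
    ∑ n ∈ range N, ‖⟪x, f n⟫‖ ^ 2 ≤ K ^ 2 * ‖x‖ ^ 2 := by
  set S := ∑ n ∈ range N, ‖⟪x, f n⟫‖ ^ 2 with hS
  have hS0 : 0 ≤ S := by positivity
  let c : lp (fun _ : ℕ => ℂ) 2 := ∑ n ∈ range N, lp.single 2 n ⟪f n, x⟫
  have hc : ‖c‖ ^ 2 = S := by
    have := lp.norm_sum_single (p := 2) (E := fun _ : ℕ => ℂ) (by norm_num)
      (fun n => ⟪f n, x⟫) (range N)
    simpa [c, hS, norm_inner_symm x] using this
  have hcn : ∀ n ∈ range N, c n = ⟪f n, x⟫ := fun n hn => by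
    simp only [c, lp.coeFn_sum, Finset.sum_apply, lp.single_apply, Pi.single_apply,
      Finset.sum_ite_eq, hn, if_true]
  have hx : ⟪x, ∑ n ∈ range N, c n • f n⟫ = (S : ℂ) := by
    rw [inner_sum, hS, Complex.ofReal_sum]
    refine sum_congr rfl fun n hn => ?_
    rw [hcn n hn, inner_smul_right, ← inner_conj_symm, Complex.conj_mul']
    push_cast
    rfl
  have hle : S ≤ ‖x‖ * (K * ‖c‖) := by
    calc S = ‖⟪x, ∑ n ∈ range N, c n • f n⟫‖ := by
          rw [hx, Complex.norm_real, Real.norm_of_nonneg hS0]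
      _ ≤ ‖x‖ * ‖∑ n ∈ range N, c n • f n‖ := norm_inner_le_norm _ _
      _ ≤ ‖x‖ * (K * ‖c‖) := by gcongr; exact h c
  nlinarith [sq_nonneg (‖c‖ - K * ‖x‖)]

open Finset in
/-- Cauchy-Schwarz for the partial sums of an `ℓ²` combination of a Bessel sequence. -/
theorem norm_inner_sum_smul_le {H : Type*} [NormedAddCommGroup H] [InnerProductSpace ℂ H]
    {f : ℕ → H} {x : H} (hx : Summable fun n => ‖⟪x, f n⟫‖ ^ 2)
    (a : lp (fun _ : ℕ => ℂ) 2) (N : ℕ) :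
    ‖⟪x, ∑ n ∈ range N, a n • f n⟫‖ ≤ ‖a‖ * √(∑' n, ‖⟪x, f n⟫‖ ^ 2) := by
  have ha : ∑ n ∈ range N, ‖a n‖ ^ 2 ≤ ‖a‖ ^ 2 := by
    simpa using lp.sum_rpow_le_norm_rpow (p := 2) (by norm_num) a (range N)
  calc ‖⟪x, ∑ n ∈ range N, a n • f n⟫‖ ≤ ∑ n ∈ range N, ‖a n‖ * ‖⟪x, f n⟫‖ := by
        rw [inner_sum]
        refine (norm_sum_le _ _).trans_eq (sum_congr rfl fun n _ => ?_)
        rw [inner_smul_right, norm_mul]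
    _ ≤ √(∑ n ∈ range N, ‖a n‖ ^ 2) * √(∑ n ∈ range N, ‖⟪x, f n⟫‖ ^ 2) :=
        Real.sum_mul_le_sqrt_mul_sqrt _ _ _
    _ ≤ √(‖a‖ ^ 2) * √(∑' n, ‖⟪x, f n⟫‖ ^ 2) := by
        gcongr
        exact hx.sum_le_tsum _ fun n _ => by positivity
    _ = ‖a‖ * √(∑' n, ‖⟪x, f n⟫‖ ^ 2) := by rw [Real.sqrt_sq (norm_nonneg a)]

/-- If `{f n}` is an atomic system for `L`, then `{f n}` is an `L`-frame. -/
theorem atomicSystem_lFrame {H : Type*} [NormedAddCommGroup H] [InnerProductSpace ℂ H]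
    [CompleteSpace H] [TopologicalSpace.SeparableSpace H] (L : H →L[ℂ] H) (f : ℕ → H)
    (hf : AtomicSystem L f) : LFrame L f := by
  obtain ⟨hconv, C, hC, hatom⟩ := hf
  obtain ⟨K, hK, hbound⟩ := exists_norm_sum_smul_le f hconv
  refine ⟨(C ^ 2)⁻¹, by positivity, K ^ 2, by positivity, fun x => ?_⟩
  have hbessel N := sum_norm_inner_sq_le_of_norm_sum_smul_le (hbound N) x
  have hsum : Summable fun n => ‖⟪x, f n⟫‖ ^ 2 :=
    summable_of_sum_range_le (fun n => by positivity) hbessel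
  refine ⟨hsum, ?_, Real.tsum_le_of_sum_range_le (fun n => by positivity) hbessel⟩
  set y := ContinuousLinearMap.adjoint L x with hy
  set S := ∑' n, ‖⟪x, f n⟫‖ ^ 2 with hS
  have hS0 : 0 ≤ S := tsum_nonneg fun n => by positivity
  obtain ⟨a, ha, hlim⟩ := hatom y
  have hle : ‖y‖ ^ 2 ≤ C * ‖y‖ * √S := by
    calc ‖y‖ ^ 2 = ‖⟪x, L y⟫‖ := by
          rw [← ContinuousLinearMap.adjoint_inner_left, ← hy, inner_self_eq_norm_sq_to_K]
          simp
      _ ≤ ‖a‖ * √S := le_of_tendsto' (tendsto_const_nhds.inner hlim).norm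
          (norm_inner_sum_smul_le hsum a)
      _ ≤ C * ‖y‖ * √S := by gcongr
  rw [inv_mul_le_iff₀ (by positivity)]
  nlinarith [sq_nonneg (‖y‖ - C * √S), Real.sq_sqrt hS0]
end

section
/- If {f_n}_{n=1}^∞ is an L-frame, i.e. there exist A, B > 0 with A‖L*x‖² ≤ Σ_{n=1}^∞ |⟨x, f_n⟩|² ≤ B‖x‖² for all x ∈ H, then {f_n}_{n=1}^∞ is an atomic system for L. -/
open Filter Topology
open scoped ComplexInnerProductSpace

/-- A sequence `g` is a *Bessel sequence* if there is `B > 0` with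
`∑' n, |⟨x, g n⟩| ^ 2 ≤ B * ‖x‖ ^ 2` for all `x`. -/
def BesselSequence {H : Type*} [NormedAddCommGroup H] [InnerProductSpace ℂ H]
    (g : ℕ → H) : Prop :=
  ∃ B > (0 : ℝ), ∀ x : H,
    Summable (fun n => ‖⟪x, g n⟫‖ ^ 2) ∧ ∑' n, ‖⟪x, g n⟫‖ ^ 2 ≤ B * ‖x‖ ^ 2

section DouglasFactorization

variable {𝕜 E F G : Type*} [RCLike 𝕜] [NormedAddCommGroup E] [InnerProductSpace 𝕜 E]
  [NormedAddCommGroup F] [InnerProductSpace 𝕜 F] [CompleteSpace F]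
  [NormedAddCommGroup G] [InnerProductSpace 𝕜 G] [CompleteSpace G]

/-- Douglas factorization: an operator dominated in norm by `T` factors through `T`. -/
theorem ContinuousLinearMap.exists_comp_eq_of_norm_le (T : E →L[𝕜] F) (R : E →L[𝕜] G) (C : ℝ)
    (h : ∀ x, ‖R x‖ ≤ C * ‖T x‖) : ∃ S : F →L[𝕜] G, S ∘L T = R := by
  let K : Submodule 𝕜 F := T.range.topologicalClosure
  have hK : ∀ x, T x ∈ K := fun x ↦ T.range.le_topologicalClosure ⟨x, rfl⟩
  have : CompleteSpace K := T.range.isClosed_topologicalClosure.completeSpace_coe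
  let e : E →ₗ[𝕜] K := T.toLinearMap.codRestrict K hK
  have he : DenseRange e :=
    ((denseRange_inclusion_iff subset_closure).2 subset_rfl).comp
      Set.rangeFactorization_surjective.denseRange (continuous_inclusion subset_closure)
  refine ⟨R.toLinearMap.extendOfNorm e ∘L K.orthogonalProjectionOnto, ?_⟩
  ext x
  have hP : K.orthogonalProjectionOnto (T x) = e x :=
    K.orthogonalProjectionOnto_mem_subspace_eq_self (e x)
  simp only [ContinuousLinearMap.comp_apply, hP]
  exact LinearMap.extendOfNorm_eq he ⟨C, h⟩ x

end DouglasFactorization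

section AnalysisOperator

variable {H : Type*} [NormedAddCommGroup H] [InnerProductSpace ℂ H]

/-- A Bessel sequence has a bounded analysis operator `x ↦ (⟪f n, x⟫)ₙ` into `ℓ²`. -/
theorem BesselSequence.exists_analysisOperator {f : ℕ → H} (hf : BesselSequence f) :
    ∃ T : H →L[ℂ] lp (fun _ : ℕ => ℂ) 2, ∀ x n, T x n = ⟪f n, x⟫ := by
  obtain ⟨B, hB, hf⟩ := hf
  have hmem : ∀ x, Memℓp (fun n ↦ ⟪f n, x⟫) 2 := fun x ↦
    memℓp_gen (by simpa [norm_inner_symm] using (hf x).1)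
  let T : H →ₗ[ℂ] lp (fun _ : ℕ => ℂ) 2 :=
    { toFun := fun x ↦ ⟨fun n ↦ ⟪f n, x⟫, hmem x⟩
      map_add' := fun x y ↦ by ext n; exact inner_add_right _ _ _
      map_smul' := fun c x ↦ by ext n; exact inner_smul_right _ _ _ }
  refine ⟨T.mkContinuous √B fun x ↦ ?_, fun x n ↦ rfl⟩
  refine le_of_sq_le_sq ?_ (by positivity)
  have hT : ‖T x‖ ^ 2 = ∑' n, ‖⟪f n, x⟫‖ ^ 2 := by
    simpa using! lp.norm_rpow_eq_tsum (p := 2) (by simp) (T x)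
  rw [hT, mul_pow, Real.sq_sqrt hB.le]
  simpa only [norm_inner_symm] using (hf x).2

/-- The adjoint of the analysis operator is the synthesis operator `c ↦ ∑ n, c n • f n`. -/
theorem hasSum_adjoint_analysisOperator [CompleteSpace H] {f : ℕ → H}
    {T : H →L[ℂ] lp (fun _ : ℕ => ℂ) 2} (hT : ∀ x n, T x n = ⟪f n, x⟫)
    (c : lp (fun _ : ℕ => ℂ) 2) :
    HasSum (fun n ↦ c n • f n) (ContinuousLinearMap.adjoint T c) := by
  have hsingle : ∀ n a, ContinuousLinearMap.adjoint T (lp.single 2 n a) = a • f n := by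
    intro n a
    refine ext_inner_right ℂ fun x ↦ ?_
    rw [ContinuousLinearMap.adjoint_inner_left, lp.inner_single_left, hT, inner_smul_left]
    simp [mul_comm]
  simpa only [hsingle] using!
    (ContinuousLinearMap.adjoint T).hasSum (lp.hasSum_single (by simp) c)

end AnalysisOperator

theorem LFrame.besselSequence {H : Type*} [NormedAddCommGroup H] [InnerProductSpace ℂ H]
    [CompleteSpace H] {L : H →L[ℂ] H} {f : ℕ → H} (hf : LFrame L f) : BesselSequence f := by
  obtain ⟨_, _, B, hB, h⟩ := hf
  exact ⟨B, hB, fun x ↦ ⟨(h x).1, (h x).2.2⟩⟩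

/-- If `{f n}` is an `L`-frame, then `{f n}` is an atomic system for `L`. -/
theorem lFrame_atomicSystem {H : Type*} [NormedAddCommGroup H] [InnerProductSpace ℂ H]
    [CompleteSpace H] [TopologicalSpace.SeparableSpace H] (L : H →L[ℂ] H) (f : ℕ → H)
    (hf : LFrame L f) : AtomicSystem L f := by
  obtain ⟨T, hT⟩ := hf.besselSequence.exists_analysisOperator
  have hsum := fun c ↦ (hasSum_adjoint_analysisOperator hT c).tendsto_sum_nat
  refine ⟨fun c ↦ ⟨_, hsum c⟩, ?_⟩
  obtain ⟨A, hA, B, -, hf⟩ := hf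
  have hbound : ∀ x, ‖ContinuousLinearMap.adjoint L x‖ ≤ (√A)⁻¹ * ‖T x‖ := by
    intro x
    have hTx : ‖T x‖ ^ 2 = ∑' n, ‖⟪x, f n⟫‖ ^ 2 := by
      simpa [hT, norm_inner_symm] using lp.norm_rpow_eq_tsum (p := 2) (by simp) (T x)
    rw [← div_eq_inv_mul, le_div_iff₀' (by positivity)]
    refine le_of_sq_le_sq ?_ (by positivity)
    rw [mul_pow, Real.sq_sqrt hA.le, hTx]
    exact (hf x).2.1
  obtain ⟨S, hS⟩ := T.exists_comp_eq_of_norm_le _ _ hbound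
  have hL : ∀ x, ContinuousLinearMap.adjoint T (ContinuousLinearMap.adjoint S x) = L x := by
    intro x
    rw [← ContinuousLinearMap.comp_apply, ← ContinuousLinearMap.adjoint_comp, hS,
      ContinuousLinearMap.adjoint_adjoint]
  refine ⟨‖ContinuousLinearMap.adjoint S‖ + 1, by positivity, fun x ↦
    ⟨ContinuousLinearMap.adjoint S x, ?_, hL x ▸ hsum _⟩⟩
  exact (ContinuousLinearMap.le_opNorm _ x).trans (by gcongr; linarith)
end

section
/- If {f_n}_{n=1}^∞ is a sequence in a Hilbert space H such that Σ_{n=1}^∞ |⟨x, f_n⟩|² < ∞ for every x ∈ H, then {f_n}_{n=1}^∞ is a Bessel sequence, i.e. there exists B > 0 such that Σ_{n=1}^∞ |⟨x, f_n⟩|² ≤ B‖x‖² for all x ∈ H. -/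
open Filter Topology
open scoped ComplexInnerProductSpace

/-- If `∑' n, |⟨x, f n⟩| ^ 2 < ∞` for every `x` in a Hilbert space, then `{f n}` is a
Bessel sequence: there is `B > 0` with `∑' n, |⟨x, f n⟩| ^ 2 ≤ B * ‖x‖ ^ 2` for all `x`. -/
theorem summable_bessel {H : Type*} [NormedAddCommGroup H] [InnerProductSpace ℂ H]
    [CompleteSpace H] (f : ℕ → H)
    (hsum : ∀ x : H, Summable (fun n => ‖⟪x, f n⟫‖ ^ 2)) :
    ∃ B > (0 : ℝ), ∀ x : H, ∑' n, ‖⟪x, f n⟫‖ ^ 2 ≤ B * ‖x‖ ^ 2 := by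
  let T : H →ₗ[ℂ] lp (fun _ : ℕ => ℂ) 2 :=
    { toFun := fun x => ⟨fun n => ⟪f n, x⟫, by
        refine memℓp_gen ?_
        simpa [norm_inner_symm x] using hsum x⟩
      map_add' := fun x y => by ext n; exact inner_add_right _ _ _
      map_smul' := fun c x => by ext n; exact inner_smul_right _ _ _ }
  have T_apply (x : H) (n : ℕ) : T x n = ⟪f n, x⟫ := rfl
  have T_closed : ∀ (u : ℕ → H) (x : H) (y : lp (fun _ : ℕ => ℂ) 2),
      Tendsto u atTop (𝓝 x) → Tendsto (T ∘ u) atTop (𝓝 y) → y = T x := by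
    intro u x y hu hTu
    ext n
    have hcoord : Tendsto (fun k => T (u k) n) atTop (𝓝 (y n)) :=
      ((continuous_apply n).comp lp.uniformContinuous_coe.continuous).continuousAt.tendsto.comp hTu
    exact tendsto_nhds_unique hcoord (tendsto_const_nhds.inner hu)
  let S : H →L[ℂ] lp (fun _ : ℕ => ℂ) 2 := .ofSeqClosedGraph @T_closed
  have norm_sq (x : H) : ‖S x‖ ^ 2 = ∑' n, ‖⟪x, f n⟫‖ ^ 2 := by
    have h := lp.norm_rpow_eq_tsum (p := 2) (by norm_num) (T x)
    have hST : S x = T x := rfl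
    rw [hST]
    simpa [T_apply, norm_inner_symm x] using h
  refine ⟨‖S‖ ^ 2 + 1, by positivity, fun x => ?_⟩
  calc ∑' n, ‖⟪x, f n⟫‖ ^ 2 = ‖S x‖ ^ 2 := (norm_sq x).symm
    _ ≤ (‖S‖ * ‖x‖) ^ 2 := by gcongr; exact S.le_opNorm x
    _ ≤ (‖S‖ ^ 2 + 1) * ‖x‖ ^ 2 := by nlinarith [sq_nonneg ‖x‖]
end

section
/- The sequence of normalized kernels {K_{λ_n}/‖K_{λ_n}‖}_{n=1}^∞ is an atomic system for L if and only if {λ_n}_{n=1}^∞ is a sampling sequence for L, i.e. there exist A, B > 0 such that A‖L*f‖² ≤ Σ_{n=1}^∞ |f(λ_n)|²/‖K_{λ_n}‖² ≤ B‖f‖² for every f ∈ H. -/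
open Filter Topology
open scoped ComplexInnerProductSpace

open ContinuousLinearMap in
/-- The majorization half of Douglas' factorization lemma, in pointwise form. -/
theorem exists_preimage_norm_le_of_norm_adjoint_le {E F G : Type*}
    [NormedAddCommGroup E] [InnerProductSpace ℂ E] [CompleteSpace E]
    [NormedAddCommGroup F] [InnerProductSpace ℂ F] [CompleteSpace F]
    [NormedAddCommGroup G] [InnerProductSpace ℂ G] [CompleteSpace G]
    (T : E →L[ℂ] F) (L : G →L[ℂ] F) {C : ℝ} (hC : 0 ≤ C)
    (h : ∀ y, ‖adjoint L y‖ ≤ C * ‖adjoint T y‖) (x : G) :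
    ∃ a : E, ‖a‖ ≤ C * ‖x‖ ∧ T a = L x := by
  obtain ⟨g, hg⟩ := (adjoint T).toLinearMap.rangeRestrict.exists_rightInverse_of_surjective
    (LinearMap.range_rangeRestrict _)
  have hTg : ∀ p, adjoint T (g p) = p := fun p =>
    congrArg Subtype.val (LinearMap.congr_fun hg p)
  let φ : StrongDual ℂ (LinearMap.range (adjoint T).toLinearMap) :=
    LinearMap.mkContinuous ((innerSL ℂ x).toLinearMap ∘ₗ (adjoint L).toLinearMap ∘ₗ g)
      (C * ‖x‖) fun p => by
        calc ‖⟪x, adjoint L (g p)⟫‖ ≤ ‖x‖ * ‖adjoint L (g p)‖ := norm_inner_le_norm _ _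
          _ ≤ ‖x‖ * (C * ‖adjoint T (g p)‖) := by gcongr; exact h _
          _ = C * ‖x‖ * ‖p‖ := by rw [hTg, Submodule.coe_norm]; ring
  obtain ⟨ψ, hψ, hψn⟩ := exists_extension_norm_eq _ φ
  refine ⟨(InnerProductSpace.toDual ℂ E).symm ψ, ?_, ext_inner_right ℂ fun y => ?_⟩
  · rw [LinearIsometryEquiv.norm_map, hψn]
    exact LinearMap.mkContinuous_norm_le _ (by positivity) _
  · have hL : adjoint L (g ((adjoint T).toLinearMap.rangeRestrict y)) = adjoint L y := by
      have := h (g ((adjoint T).toLinearMap.rangeRestrict y) - y)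
      rw [map_sub, map_sub, hTg] at this
      simpa [sub_eq_zero] using this
    rw [← adjoint_inner_right, InnerProductSpace.toDual_symm_apply, ← adjoint_inner_right, ← hL]
    exact hψ ((adjoint T).toLinearMap.rangeRestrict y)

theorem lp.hasSum_norm_sq (a : lp (fun _ : ℕ => ℂ) 2) : HasSum (fun n => ‖a n‖ ^ 2) (‖a‖ ^ 2) := by
  simpa using lp.hasSum_norm (p := 2) (by simp) a

section SynthesisOperator

variable {H : Type*} [NormedAddCommGroup H] [InnerProductSpace ℂ H]

/-- If `∑ n, c n • f n` converges for every `c ∈ ℓ²`, the sum is a bounded operator of `c`. -/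
theorem exists_synthesis_of_forall_tendsto {f : ℕ → H}
    (h : ∀ c : lp (fun _ : ℕ => ℂ) 2,
      ∃ y : H, Tendsto (fun N => ∑ n ∈ Finset.range N, c n • f n) atTop (𝓝 y)) :
    ∃ T : lp (fun _ : ℕ => ℂ) 2 →L[ℂ] H,
      ∀ c, Tendsto (fun N => ∑ n ∈ Finset.range N, c n • f n) atTop (𝓝 (T c)) := by
  choose t ht using h
  let S : ℕ → lp (fun _ : ℕ => ℂ) 2 →L[ℂ] H := fun N =>
    ∑ n ∈ Finset.range N, (innerSL ℂ (lp.single 2 n (1 : ℂ))).smulRight (f n)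
  have hS : ∀ N c, S N c = ∑ n ∈ Finset.range N, c n • f n := fun N c => by
    simp [S, lp.inner_single_left]
  have hlim : Tendsto (fun N c => S N c) atTop (𝓝 t) :=
    tendsto_pi_nhds.2 fun c => by simpa only [hS] using ht c
  exact ⟨continuousLinearMapOfTendsto S hlim, ht⟩

variable [CompleteSpace H]

open ContinuousLinearMap in
/-- If `T c = ∑ n, c n • f n` for all `c ∈ ℓ²`, then `T* x = (⟪f n, x⟫)ₙ`. -/
theorem adjoint_apply_of_tendsto_sum {f : ℕ → H} {T : lp (fun _ : ℕ => ℂ) 2 →L[ℂ] H}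
    (hT : ∀ c, Tendsto (fun N => ∑ n ∈ Finset.range N, c n • f n) atTop (𝓝 (T c)))
    (x : H) (n : ℕ) : adjoint T x n = ⟪f n, x⟫ := by
  have hs : T (lp.single 2 n 1) = f n := by
    refine tendsto_nhds_unique (hT _) (tendsto_const_nhds.congr' ?_)
    filter_upwards [eventually_gt_atTop n] with N hN
    rw [Finset.sum_eq_single_of_mem n (Finset.mem_range.2 hN)]
    · simp
    · intro m _ hm
      simp [hm]
  rw [← hs, ← adjoint_inner_right, lp.inner_single_left]
  simp

open ContinuousLinearMap in
theorem hasSum_norm_inner_sq_of_tendsto_sum {f : ℕ → H} {T : lp (fun _ : ℕ => ℂ) 2 →L[ℂ] H}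
    (hT : ∀ c, Tendsto (fun N => ∑ n ∈ Finset.range N, c n • f n) atTop (𝓝 (T c))) (x : H) :
    HasSum (fun n => ‖⟪x, f n⟫‖ ^ 2) (‖adjoint T x‖ ^ 2) := by
  simpa only [adjoint_apply_of_tendsto_sum hT, norm_inner_symm] using
    lp.hasSum_norm_sq (adjoint T x)

open ContinuousLinearMap in
/-- The synthesis operator of a Bessel sequence is bounded on `ℓ²`. -/
theorem BesselSequence.exists_synthesis {f : ℕ → H} (hf : BesselSequence f) :
    ∃ T : lp (fun _ : ℕ => ℂ) 2 →L[ℂ] H,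
      ∀ c, Tendsto (fun N => ∑ n ∈ Finset.range N, c n • f n) atTop (𝓝 (T c)) := by
  obtain ⟨B, hB, h⟩ := hf
  have hmem : ∀ x, Memℓp (fun n => ⟪f n, x⟫) 2 := fun x =>
    memℓp_gen (by simpa [norm_inner_symm] using (h x).1)
  let U₀ : H →ₗ[ℂ] lp (fun _ : ℕ => ℂ) 2 :=
    { toFun := fun x => ⟨fun n => ⟪f n, x⟫, hmem x⟩
      map_add' := fun x y => by ext n; exact inner_add_right _ _ _
      map_smul' := fun c x => by ext n; exact inner_smul_right _ _ _ }
  have hU₀ : ∀ x n, U₀ x n = ⟪f n, x⟫ := fun _ _ => rfl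
  let U := U₀.mkContinuous √B fun x => by
    rw [← Real.sqrt_sq (norm_nonneg x), ← Real.sqrt_mul hB.le]
    refine Real.le_sqrt_of_sq_le ?_
    rw [← (lp.hasSum_norm_sq (U₀ x)).tsum_eq]
    simpa only [hU₀, norm_inner_symm] using (h x).2
  have hU : ∀ n, adjoint U (lp.single 2 n 1) = f n := fun n => ext_inner_right ℂ fun y => by
    rw [adjoint_inner_left, lp.inner_single_left]
    simp [U, hU₀]
  refine ⟨adjoint U, fun c => ?_⟩
  convert ((lp.hasSum_single (by simp) c).mapL (adjoint U)).tendsto_sum_nat using 4 with N n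
  rw [← hU, ← map_smul, ← lp.single_smul]
  simp

open ContinuousLinearMap in
theorem atomicSystem_iff_lFrame (L : H →L[ℂ] H) (f : ℕ → H) :
    AtomicSystem L f ↔ LFrame L f := by
  constructor
  · rintro ⟨hconv, C, hC, hL⟩
    obtain ⟨T, hT⟩ := exists_synthesis_of_forall_tendsto hconv
    have hsum := hasSum_norm_inner_sq_of_tendsto_sum hT
    refine ⟨(C ^ 2)⁻¹, by positivity, ‖T‖ ^ 2 + 1, by positivity, fun x => ⟨(hsum x).summable, ?_⟩⟩
    rw [(hsum x).tsum_eq]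
    constructor
    · obtain ⟨a, ha, hax⟩ := hL (adjoint L x)
      have hTa : T a = L (adjoint L x) := tendsto_nhds_unique (hT a) hax
      have hsq : ‖adjoint L x‖ * ‖adjoint L x‖ ≤ C * ‖adjoint T x‖ * ‖adjoint L x‖ := by
        calc ‖adjoint L x‖ * ‖adjoint L x‖ = ‖⟪adjoint L x, adjoint L x⟫‖ := by
              rw [inner_self_eq_norm_sq_to_K, norm_pow, RCLike.norm_ofReal, abs_norm, sq]
          _ = ‖⟪a, adjoint T x⟫‖ := by rw [adjoint_inner_right, adjoint_inner_right, hTa]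
          _ ≤ ‖a‖ * ‖adjoint T x‖ := norm_inner_le_norm _ _
          _ ≤ C * ‖adjoint L x‖ * ‖adjoint T x‖ := by gcongr
          _ = C * ‖adjoint T x‖ * ‖adjoint L x‖ := by ring
      have hle : ‖adjoint L x‖ ≤ C * ‖adjoint T x‖ := by
        rcases (norm_nonneg (adjoint L x)).eq_or_lt with h0 | h0
        · rw [← h0]; positivity
        · exact le_of_mul_le_mul_right hsq h0
      rw [inv_mul_le_iff₀ (by positivity), ← mul_pow]
      gcongr
    · calc ‖adjoint T x‖ ^ 2 ≤ (‖adjoint T‖ * ‖x‖) ^ 2 := by gcongr; exact le_opNorm _ _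
        _ = ‖T‖ ^ 2 * ‖x‖ ^ 2 := by rw [LinearIsometryEquiv.norm_map, mul_pow]
        _ ≤ (‖T‖ ^ 2 + 1) * ‖x‖ ^ 2 := by gcongr; linarith
  · rintro ⟨A, hA, B, hB, h⟩
    obtain ⟨T, hT⟩ := BesselSequence.exists_synthesis ⟨B, hB, fun x => ⟨(h x).1, (h x).2.2⟩⟩
    refine ⟨fun c => ⟨T c, hT c⟩, (√A)⁻¹, by positivity, fun x => ?_⟩
    have hle : ∀ y, ‖adjoint L y‖ ≤ (√A)⁻¹ * ‖adjoint T y‖ := fun y => by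
      have hy := (h y).2.1
      rw [(hasSum_norm_inner_sq_of_tendsto_sum hT y).tsum_eq] at hy
      rw [le_inv_mul_iff₀ (by positivity)]
      refine le_of_sq_le_sq ?_ (norm_nonneg _)
      rwa [mul_pow, Real.sq_sqrt hA.le]
    obtain ⟨a, ha, hTa⟩ :=
      exists_preimage_norm_le_of_norm_adjoint_le T L (by positivity) hle x
    exact ⟨a, ha, hTa ▸ hT a⟩

end SynthesisOperator

/-- In a reproducing kernel Hilbert space `(H, K)` of functions on `Ω` (with evaluation
`ev`, kernels `K μ`, reproducing property `ev f μ = ⟨f, K μ⟩`), for a sequence of pairwise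
distinct points `Λ n` with nonzero kernels: the normalized kernels
`K (Λ n) / ‖K (Λ n)‖` form an atomic system for `L` if and only if `{Λ n}` is a sampling
sequence for `L`, i.e. there are `A, B > 0` with
`A * ‖L* f‖ ^ 2 ≤ ∑' n, |f (Λ n)| ^ 2 / ‖K (Λ n)‖ ^ 2 ≤ B * ‖f‖ ^ 2` for all `f`. -/
theorem rkhs_atomicSystem_iff_sampling {Ω : Type*} [Nonempty Ω]
    {H : Type*} [NormedAddCommGroup H] [InnerProductSpace ℂ H] [CompleteSpace H]
    [TopologicalSpace.SeparableSpace H]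
    (ev : H → Ω → ℂ) (hev : Function.Injective ev) (K : Ω → H)
    (hrep : ∀ (f : H) (μ : Ω), ev f μ = ⟪f, K μ⟫)
    (Λ : ℕ → Ω) (hΛ : Function.Injective Λ) (hK0 : ∀ n, K (Λ n) ≠ 0)
    (L : H →L[ℂ] H) :
    AtomicSystem L (fun n => ((‖K (Λ n)‖ : ℂ))⁻¹ • K (Λ n)) ↔
    ∃ A > (0 : ℝ), ∃ B > (0 : ℝ), ∀ f : H,
      Summable (fun n => ‖ev f (Λ n)‖ ^ 2 / ‖K (Λ n)‖ ^ 2) ∧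
      A * ‖ContinuousLinearMap.adjoint L f‖ ^ 2 ≤
        ∑' n, ‖ev f (Λ n)‖ ^ 2 / ‖K (Λ n)‖ ^ 2 ∧
      ∑' n, ‖ev f (Λ n)‖ ^ 2 / ‖K (Λ n)‖ ^ 2 ≤ B * ‖f‖ ^ 2 := by
  have hnorm : ∀ (f : H) (n : ℕ), ‖⟪f, ((‖K (Λ n)‖ : ℂ))⁻¹ • K (Λ n)⟫‖ ^ 2 =
      ‖ev f (Λ n)‖ ^ 2 / ‖K (Λ n)‖ ^ 2 := fun f n => by
    rw [hrep, inner_smul_right, norm_mul, norm_inv, Complex.norm_real, norm_norm, mul_pow,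
      inv_pow, inv_mul_eq_div]
  rw [atomicSystem_iff_lFrame]
  simp only [LFrame, hnorm]
end
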